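/- Let ν be a group with a perfect normal subgroup κ such that the quotient ν/κ is solvable. If ν is a free product G * H, then either G is perfect, or H is perfect, or ν/κ is isomorphic to the infinite dihedral group ℤ/2 * ℤ/2. -/

import Mathlib

open Monoid

section Solvable

theorem derivedSeries_pi_apply_mem {ι : Type*} {T : Type*} [Group T] (n : ℕ) {f : ι → T}
    (hf : f ∈ derivedSeries (ι → T) n) (i : ι) : f i ∈ derivedSeries T n :=
  map_derivedSeries_le_derivedSeries (Pi.evalMonoidHom (fun _ : ι => T) i) n ⟨f, hf, rfl⟩

theorem Group.isSolvable_pi (ι : Type*) (T : Type*) [Group T] [Group.IsSolvable T] :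
    Group.IsSolvable (ι → T) := by
  obtain ⟨n, hn⟩ := (Group.isSolvable_def T).mp inferInstance
  refine (Group.isSolvable_def _).mpr ⟨n, eq_bot_iff.mpr fun f hf => ?_⟩
  rw [Subgroup.mem_bot]
  funext i
  have := derivedSeries_pi_apply_mem n hf i
  rwa [hn, Subgroup.mem_bot] at this

theorem RegularWreathProduct.isSolvable (T K : Type*) [Group T] [Group K] [Group.IsSolvable T]
    [Group.IsSolvable K] : Group.IsSolvable (T ≀ᵣ K) := by
  have := Group.isSolvable_pi K T
  let f : (K → T) →* T ≀ᵣ K :=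
    { toFun := fun m => ⟨m, 1⟩
      map_one' := rfl
      map_mul' := fun a b => by ext <;> simp }
  refine Group.isSolvable_of_ker_le_range f RegularWreathProduct.rightHom fun x hx => ⟨x.left, ?_⟩
  have hx' : x.right = 1 := hx
  ext <;> simp [f, hx']

theorem DihedralGroup.isSolvable (n : ℕ) : Group.IsSolvable (DihedralGroup n) := by
  let f : Multiplicative (ZMod n) →* DihedralGroup n :=
    { toFun := fun i => r i.toAdd
      map_one' := rfl
      map_mul' := fun a b => by simp }
  let g : DihedralGroup n →* Multiplicative (ZMod 2) :=
    { toFun := fun x => match x with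
        | r _ => 1
        | sr _ => Multiplicative.ofAdd 1
      map_one' := rfl
      map_mul' := by
        rintro (i | i) (j | j)
        · rfl
        · rfl
        · rfl
        · exact (by decide : (1 : Multiplicative (ZMod 2)) =
            Multiplicative.ofAdd 1 * Multiplicative.ofAdd 1) }
  refine Group.isSolvable_of_ker_le_range f g fun x hx => ?_
  rcases x with i | i
  · exact ⟨Multiplicative.ofAdd i, rfl⟩
  · exact absurd (show Multiplicative.ofAdd (1 : ZMod 2) = 1 from hx) (by decide)

theorem Subgroup.map_eq_bot_of_perfect {N S : Type*} [Group N] [Group S] [Group.IsSolvable S]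
    {K : Subgroup N} (hK : ⁅K, K⁆ = K) (f : N →* S) : K.map f = ⊥ := by
  by_contra h
  have := Group.IsSolvable.commutator_lt_of_ne_bot h
  rw [← Subgroup.map_commutator, hK] at this
  exact this.false

end Solvable

section FreeGroup

theorem IsFreeGroup.subsingleton_of_perfect (F : Type*) [Group F] [IsFreeGroup F]
    (h : commutator F = ⊤) : Subsingleton F := by
  have hX : IsEmpty (IsFreeGroup.Generators F) := by
    refine ⟨fun x => ?_⟩
    let f : F →* Multiplicative ℤ := IsFreeGroup.lift fun _ => Multiplicative.ofAdd 1
    have hx : IsFreeGroup.of x ∈ f.ker :=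
      Abelianization.commutator_subset_ker f (h ▸ Subgroup.mem_top _)
    rw [MonoidHom.mem_ker, IsFreeGroup.lift_of] at hx
    exact absurd hx (by decide)
  exact (IsFreeGroup.toFreeGroup F).toEquiv.subsingleton

theorem FreeGroup.not_isSolvable_fin_two : ¬ Group.IsSolvable (FreeGroup (Fin 2)) := by
  intro _
  let σ : Equiv.Perm (Fin 5) := finRotate 5
  let f : FreeGroup (Fin 2) →* Equiv.Perm (Fin 5) :=
    FreeGroup.lift ![σ, Equiv.swap 0 (σ 0)]
  have hf : Function.Surjective f := by
    rw [← MonoidHom.range_eq_top, eq_top_iff,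
      ← Equiv.Perm.closure_cycle_adjacent_swap (σ := σ) isCycle_finRotate support_finRotate 0,
      Subgroup.closure_le]
    rintro x (rfl | rfl)
    · exact ⟨FreeGroup.of 0, by simp [f]⟩
    · exact ⟨FreeGroup.of 1, by simp [f]⟩
  exact Equiv.Perm.not_isSolvable_fin_5 (Group.isSolvable_of_surjective hf)

theorem FreeGroup.not_derivedSeries_le_succ (d : ℕ) :
    ¬ derivedSeries (FreeGroup (Fin 2)) d ≤ derivedSeries (FreeGroup (Fin 2)) (d + 1) := by
  intro h
  refine FreeGroup.not_isSolvable_fin_two ((Group.isSolvable_def _).mpr ⟨d, ?_⟩)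
  set D := derivedSeries (FreeGroup (Fin 2)) d
  have hD : ⁅D, D⁆ = D := le_antisymm D.commutator_le_self h
  have hperf : commutator D = ⊤ := by
    apply Subgroup.map_injective D.subtype_injective
    rw [Subgroup.map_subtype_commutator, hD, ← MonoidHom.range_eq_map, D.range_subtype]
  exact @Subgroup.eq_bot_of_subsingleton _ _ D (IsFreeGroup.subsingleton_of_perfect D hperf)

end FreeGroup

section Wreath

open RegularWreathProduct
open scoped commutatorElement

theorem exists_hom_wreath_commutator {P R T : Type*} [Group P] [Group R] [Group T]
    (μ : P × R → T) (hP : ∀ a, μ (a, 1) = 1) (hR : ∀ b, μ (1, b) = 1) :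
    ∃ (φ : P →* T ≀ᵣ (P × R)) (ψ : R →* T ≀ᵣ (P × R)),
      ∀ a b, ⁅φ a, ψ b⁆.right = 1 ∧ ⁅φ a, ψ b⁆.left 1 = μ (a, b) := by
  let m : T ≀ᵣ (P × R) := ⟨fun x => μ x⁻¹, 1⟩
  refine ⟨(MulAut.conj m).toMonoidHom.comp (inl.comp (MonoidHom.inl P R)),
    inl.comp (MonoidHom.inr P R), fun a b => ⟨?_, ?_⟩⟩
  · ext <;> simp [commutatorElement_def, m]
  · have h1 : μ 1 = 1 := hP 1
    simp [commutatorElement_def, m, hP, hR, h1]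

/-- If homomorphisms from two subgroups of a solvable group to any solvable group extend jointly
to the whole group, then there is at most one pair of nontrivial elements of these subgroups. -/
theorem eq_and_eq_of_solvable_coprod.{u} {Q : Type u} [Group Q] [Group.IsSolvable Q]
    (P R : Subgroup Q)
    (hlift : ∀ (S : Type u) [Group S] [Group.IsSolvable S] (φ : P →* S) (ψ : R →* S),
      ∃ χ : Q →* S, (∀ a : P, χ a = φ a) ∧ ∀ b : R, χ b = ψ b)
    {a a' : P} {b b' : R} (ha : a ≠ 1) (ha' : a' ≠ 1) (hb : b ≠ 1) (hb' : b' ≠ 1) :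
    (a, b) = (a', b') := by
  classical
  by_contra hne
  obtain ⟨d, hd⟩ := (Group.isSolvable_def Q).mp inferInstance
  let D := derivedSeries (FreeGroup (Fin 2)) (d + 1)
  let T := FreeGroup (Fin 2) ⧸ D
  let t : Fin 2 → T := fun i => QuotientGroup.mk' D (FreeGroup.of i)
  have hT : Group.IsSolvable T := by
    refine (Group.isSolvable_def _).mpr ⟨d + 1, ?_⟩
    rw [← map_derivedSeries_eq (QuotientGroup.mk'_surjective D) (d + 1),
      QuotientGroup.map_mk'_self]
  let μ : P × R → T := fun x => if x = (a, b) then t 0 else if x = (a', b') then t 1 else 1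
  obtain ⟨φ, ψ, hφψ⟩ := exists_hom_wreath_commutator μ
    (fun c => by simp [μ, hb.symm, hb'.symm]) (fun c => by simp [μ, ha.symm, ha'.symm])
  have := RegularWreathProduct.isSolvable T (P × R)
  obtain ⟨χ, hχP, hχR⟩ := hlift (T ≀ᵣ (P × R)) φ ψ
  let w : FreeGroup (Fin 2) →* Q :=
    FreeGroup.lift ![⁅(a : Q), (b : Q)⁆, ⁅(a' : Q), (b' : Q)⁆]
  have hright : (rightHom.comp χ).comp w = 1 := by
    ext i : 1
    fin_cases i
    · simpa [w, map_commutatorElement, hχP, hχR] using (hφψ a b).1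
    · simpa [w, map_commutatorElement, hχP, hχR] using (hφψ a' b').1
  have hright' (f) : (χ (w f)).right = 1 := DFunLike.congr_fun hright f
  let e : FreeGroup (Fin 2) →* T :=
    { toFun := fun f => (χ (w f)).left 1
      map_one' := by simp
      map_mul' := fun f g => by simp [hright'] }
  have he : e = QuotientGroup.mk' D := by
    ext i : 1
    fin_cases i
    · simpa [e, w, map_commutatorElement, hχP, hχR, μ] using (hφψ a b).2
    · simpa [e, w, map_commutatorElement, hχP, hχR, μ, Ne.symm hne] using (hφψ a' b').2
  refine FreeGroup.not_derivedSeries_le_succ d fun f hf => ?_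
  have hw : w f = 1 := by
    have := map_derivedSeries_le_derivedSeries w d ⟨f, hf, rfl⟩
    rwa [hd, Subgroup.mem_bot] at this
  have hef : e f = 1 := by simp [e, hw]
  rw [he] at hef
  exact (QuotientGroup.eq_one_iff f).mp hef

end Wreath

section Dihedral

open DihedralGroup

theorem nonempty_mulEquiv_dihedralGroup_zero {Q : Type*} [Group Q] {p q : Q} (hp : p * p = 1)
    (hq : q * q = 1) (hpq : Subgroup.closure {p, q} = ⊤) (χ : Q →* DihedralGroup 0)
    (hχp : χ p = sr 0) (hχq : χ q = sr 1) : Nonempty (Q ≃* DihedralGroup 0) := by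
  have hχz (i : ℤ) : χ ((p * q) ^ i) = r (Int.cast i : ZMod 0) := by
    rw [map_zpow, map_mul, hχp, hχq, sr_mul_sr, sub_zero, r_one_zpow]
  have hp' : p⁻¹ = p := inv_eq_of_mul_eq_one_left hp
  have hq' : q⁻¹ = q := inv_eq_of_mul_eq_one_left hq
  have hform (x : Q) : ∃ i : ℤ, x = (p * q) ^ i ∨ x = p * (p * q) ^ i := by
    have hpx (x : Q) (hx : ∃ i : ℤ, x = (p * q) ^ i ∨ x = p * (p * q) ^ i) :
        ∃ i : ℤ, p * x = (p * q) ^ i ∨ p * x = p * (p * q) ^ i := by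
      obtain ⟨i, rfl | rfl⟩ := hx
      · exact ⟨i, .inr rfl⟩
      · exact ⟨i, .inl (by rw [← mul_assoc, hp, one_mul])⟩
    have hqx (x : Q) (hx : ∃ i : ℤ, x = (p * q) ^ i ∨ x = p * (p * q) ^ i) :
        ∃ i : ℤ, q * x = (p * q) ^ i ∨ q * x = p * (p * q) ^ i := by
      obtain ⟨i, rfl | rfl⟩ := hx
      · refine ⟨1 + i, .inr ?_⟩
        rw [zpow_add, zpow_one, ← mul_assoc, ← mul_assoc, hp, one_mul]
      · refine ⟨-1 + i, .inl ?_⟩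
        rw [zpow_add, zpow_neg_one, mul_inv_rev, hp', hq', mul_assoc]
    have hx : x ∈ Subgroup.closure {p, q} := hpq ▸ Subgroup.mem_top x
    induction hx using Subgroup.closure_induction_left with
    | one => exact ⟨0, .inl (zpow_zero _).symm⟩
    | mul_left y hy x _ ih =>
      rcases hy with rfl | rfl
      · exact hpx x ih
      · exact hqx x ih
    | inv_mul_cancel y hy x _ ih =>
      rcases hy with rfl | rfl
      · exact hp'.symm ▸ hpx x ih
      · exact hq'.symm ▸ hqx x ih
  refine ⟨MulEquiv.ofBijective χ ⟨(injective_iff_map_eq_one χ).mpr fun x hx => ?_, ?_⟩⟩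
  · obtain ⟨i, rfl | rfl⟩ := hform x
    · rw [hχz, one_def, r.injEq] at hx
      rw [(ZMod.intCast_zmod_eq_zero_iff_dvd i 0).mp hx |> zero_dvd_iff.mp, zpow_zero]
    · rw [map_mul, hχz, hχp, sr_mul_r, one_def] at hx
      cases hx
  · rintro (i | i)
    · obtain ⟨k, rfl⟩ := ZMod.intCast_surjective i
      exact ⟨(p * q) ^ k, hχz k⟩
    · obtain ⟨k, rfl⟩ := ZMod.intCast_surjective i
      refine ⟨p * (p * q) ^ k, ?_⟩
      rw [map_mul, hχz, hχp, sr_mul_r, zero_add]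

theorem mul_self_eq_one_of_forall_eq {P : Type*} [Group P] {p : P} (h : ∀ a : P, a ≠ 1 → a = p)
    (hp : p ≠ 1) : p * p = 1 := by
  by_contra hpp
  exact hp (mul_eq_left.mp (h _ hpp))

theorem exists_hom_of_forall_eq {P S : Type*} [Group P] [Group S] {p : P} (hp : p ≠ 1)
    (h : ∀ a : P, a ≠ 1 → a = p) {s : S} (hs : s * s = 1) : ∃ φ : P →* S, φ p = s := by
  classical
  have hpp := mul_self_eq_one_of_forall_eq h hp
  refine ⟨{ toFun := fun a => if a = 1 then 1 else s, map_one' := if_pos rfl, map_mul' := ?_ },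
    if_neg hp⟩
  intro a b
  by_cases ha : a = 1
  · simp [ha]
  by_cases hb : b = 1
  · simp [hb]
  rw [h a ha, h b hb]
  simp [hpp, hp, hs]

end Dihedral

section Coprod

variable {G H : Type*} [Group G] [Group H] (κ : Subgroup (Coprod G H)) [κ.Normal]

theorem exists_hom_quotient_coprod (hperf : ⁅κ, κ⁆ = κ) {S : Type*} [Group S]
    [Group.IsSolvable S] (φ : G →* S) (ψ : H →* S) :
    ∃ χ : Coprod G H ⧸ κ →* S, (∀ g, χ (QuotientGroup.mk' κ (Coprod.inl g)) = φ g) ∧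
      ∀ h, χ (QuotientGroup.mk' κ (Coprod.inr h)) = ψ h := by
  have hκ : κ ≤ (Coprod.lift φ ψ).ker :=
    (Subgroup.map_eq_bot_iff κ).mp (Subgroup.map_eq_bot_of_perfect hperf _)
  exact ⟨QuotientGroup.lift κ (Coprod.lift φ ψ) hκ, fun g => by simp, fun h => by simp⟩

theorem exists_abelianization_of_ne_one (h : commutator G ≠ ⊤) :
    ∃ g : G, Abelianization.of g ≠ 1 := by
  by_contra! h'
  refine h (eq_top_iff.mpr fun g _ => ?_)
  rw [← Abelianization.ker_of]
  exact h' g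

end Coprod

/-- Let `ν = G * H` be a free product with a perfect normal subgroup `κ` such that
`ν/κ` is solvable. Then `G` is perfect, or `H` is perfect, or `ν/κ` is isomorphic to
the infinite dihedral group (`DihedralGroup 0`, i.e. `ℤ/2 * ℤ/2`). -/
theorem stmt_0 (G H : Type*) [Group G] [Group H]
    (κ : Subgroup (Coprod G H)) [κ.Normal]
    (hperf : ⁅κ, κ⁆ = κ)
    (hsolv : IsSolvable (Coprod G H ⧸ κ)) :
    commutator G = ⊤ ∨ commutator H = ⊤ ∨
      Nonempty ((Coprod G H ⧸ κ) ≃* DihedralGroup 0) := by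
  by_contra! hcon
  obtain ⟨hG, hH, hD⟩ := hcon
  have hsolv' : Group.IsSolvable (Coprod G H ⧸ κ) := hsolv
  let i : G →* Coprod G H ⧸ κ := (QuotientGroup.mk' κ).comp Coprod.inl
  let j : H →* Coprod G H ⧸ κ := (QuotientGroup.mk' κ).comp Coprod.inr
  have hlift (S : Type _) [Group S] [Group.IsSolvable S] (φ : i.range →* S) (ψ : j.range →* S) :
      ∃ χ : Coprod G H ⧸ κ →* S, (∀ a : i.range, χ a = φ a) ∧ ∀ b : j.range, χ b = ψ b := by
    obtain ⟨χ, hχG, hχH⟩ := exists_hom_quotient_coprod κ hperf (φ.comp i.rangeRestrict)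
      (ψ.comp j.rangeRestrict)
    refine ⟨χ, ?_, ?_⟩
    · rintro ⟨_, g, rfl⟩
      exact hχG g
    · rintro ⟨_, h, rfl⟩
      exact hχH h
  obtain ⟨g, hg⟩ := exists_abelianization_of_ne_one hG
  obtain ⟨h, hh⟩ := exists_abelianization_of_ne_one hH
  have hp : i.rangeRestrict g ≠ 1 := by
    intro h1
    obtain ⟨χ, hχ, -⟩ := exists_hom_quotient_coprod κ hperf (Abelianization.of (G := G)) 1
    have h2 : i g = 1 := congrArg Subtype.val h1
    exact hg (by rw [← hχ g, ← map_one χ, ← h2]; rfl)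
  have hq : j.rangeRestrict h ≠ 1 := by
    intro h1
    obtain ⟨χ, -, hχ⟩ := exists_hom_quotient_coprod κ hperf 1 (Abelianization.of (G := H))
    have h2 : j h = 1 := congrArg Subtype.val h1
    exact hh (by rw [← hχ h, ← map_one χ, ← h2]; rfl)
  have hP (a : i.range) (ha : a ≠ 1) : a = i.rangeRestrict g :=
    congrArg Prod.fst (eq_and_eq_of_solvable_coprod _ _ hlift ha hp hq hq)
  have hR (b : j.range) (hb : b ≠ 1) : b = j.rangeRestrict h :=
    congrArg Prod.snd (eq_and_eq_of_solvable_coprod _ _ hlift hp hp hb hq)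
  obtain ⟨φ, hφ⟩ := exists_hom_of_forall_eq hp hP (DihedralGroup.sr_mul_self (n := 0) 0)
  obtain ⟨ψ, hψ⟩ := exists_hom_of_forall_eq hq hR (DihedralGroup.sr_mul_self (n := 0) 1)
  have := DihedralGroup.isSolvable 0
  obtain ⟨χ, hχG, hχH⟩ := exists_hom_quotient_coprod κ hperf (φ.comp i.rangeRestrict)
    (ψ.comp j.rangeRestrict)
  refine hD.false (nonempty_mulEquiv_dihedralGroup_zero (p := i g) (q := j h)
    (congrArg Subtype.val (mul_self_eq_one_of_forall_eq hP hp))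
    (congrArg Subtype.val (mul_self_eq_one_of_forall_eq hR hq)) ?_ χ
    ((hχG g).trans hφ) ((hχH h).trans hψ)).some
  have hi : i.range ≤ Subgroup.closure {i g, j h} := by
    intro x hx
    by_cases h1 : x = 1
    · exact h1 ▸ one_mem _
    · have := congrArg Subtype.val (hP ⟨x, hx⟩ fun h2 => h1 (congrArg Subtype.val h2))
      exact Subgroup.subset_closure (.inl this)
  have hj : j.range ≤ Subgroup.closure {i g, j h} := by
    intro x hx
    by_cases h1 : x = 1
    · exact h1 ▸ one_mem _
    · have := congrArg Subtype.val (hR ⟨x, hx⟩ fun h2 => h1 (congrArg Subtype.val h2))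
      exact Subgroup.subset_closure (.inr this)
  rw [eq_top_iff, ← (QuotientGroup.mk' κ).range_eq_top.mpr (QuotientGroup.mk'_surjective κ),
    Coprod.range_eq]
  exact sup_le hi hj
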